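/- arXiv:1605.09363 — 10 statements merged into one kernel-verified Lean document; each statement's English description precedes it below -/
import Mathlib

section
/- Let a, b ∈ ℂ[X] be coprime polynomials that are not both constant, and set N = max(deg a, deg b) (so N ≥ 1). Let t₁, …, t_r ∈ ℂ be pairwise distinct. Then ∑_{i=1}^r ∑_u (m_u^{(i)} − 1) ≤ 2N − 2, where for each i the inner sum runs over the distinct complex roots u of the polynomial a − tᵢ·b and m_u^{(i)} is the multiplicity of u as a root of a − tᵢ·b. Equivalently, ∑_{i=1}^r ( (number of roots of a − tᵢ b counted with multiplicity) − (number of distinct roots of a − tᵢ b) ) ≤ 2N − 2. -/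
open Polynomial

section

open EuclideanDomain UniqueFactorizationMonoid

variable {k : Type*} [Field k]

theorem card_roots_sub_card_toFinset_le_natDegree_divRadical [DecidableEq k] [PerfectField k]
    (f : k[X]) :
    Multiset.card f.roots - f.roots.toFinset.card ≤ (divRadical f).natDegree := by
  by_cases hf : f = 0
  · simp [hf]
  have hnodup : (radical f).roots.Nodup :=
    nodup_roots (PerfectField.separable_iff_squarefree.mpr squarefree_radical)
  have hroots : f.roots = (radical f).roots + (divRadical f).roots := by
    rw [← roots_mul (by rwa [radical_mul_divRadical]), radical_mul_divRadical]
  have hcard : Multiset.card (radical f).roots ≤ f.roots.toFinset.card := by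
    rw [← Multiset.toFinset_card_of_nodup hnodup]
    exact Finset.card_le_card (Multiset.toFinset_subset.mpr
      (Multiset.subset_of_le (hroots ▸ Multiset.le_add_right _ _)))
  have hsum := congrArg Multiset.card hroots
  rw [Multiset.card_add] at hsum
  have := card_roots' (divRadical f)
  omega

theorem wronskian_sub_C_mul_left (a b : k[X]) (c : k) :
    wronskian (a - C c * b) b = wronskian a b := by
  simp only [wronskian, derivative_sub, derivative_mul, derivative_C]
  ring

/-- Subtracting a multiple of `b` from `a` cancels leading terms of equal degree, which improves
`Polynomial.natDegree_wronskian_lt_add` by one in that case. -/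
theorem natDegree_wronskian_le_two_mul_max_sub_two {a b : k[X]} (hw : wronskian a b ≠ 0) :
    (wronskian a b).natDegree ≤ 2 * max a.natDegree b.natDegree - 2 := by
  have hlt := natDegree_wronskian_lt_add hw
  rcases ne_or_eq a.natDegree b.natDegree with hne | heq
  · omega
  have hb : b.leadingCoeff ≠ 0 := by
    rw [leadingCoeff_ne_zero]
    rintro rfl
    exact hw (wronskian_zero_right a)
  set c := a.leadingCoeff / b.leadingCoeff
  have hdeg : (a - C c * b).natDegree ≤ b.natDegree - 1 := by
    refine natDegree_le_pred
      (natDegree_sub_le_of_le heq.le (natDegree_C_mul_le c b) |>.trans (max_self _).le) ?_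
    rw [coeff_sub, coeff_C_mul, coeff_natDegree, div_mul_cancel₀ _ hb, ← heq, coeff_natDegree,
      sub_self]
  have hlt' := natDegree_wronskian_lt_add (a := a - C c * b) (b := b)
    (by rwa [wronskian_sub_C_mul_left])
  rw [wronskian_sub_C_mul_left] at hlt'
  omega

theorem isCoprime_sub_C_mul {a b : k[X]} (hab : IsCoprime a b) {s t : k} (hst : s ≠ t) :
    IsCoprime (a - C s * b) (a - C t * b) := by
  have hs : IsCoprime (a - C s * b) b := by
    simpa [sub_eq_add_neg] using hab.add_mul_right_left (-C s)
  have hu : IsUnit (C (s - t)) := isUnit_C.mpr (sub_ne_zero.mpr hst).isUnit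
  have := ((isCoprime_mul_unit_left_right hu _ b).mpr hs).add_mul_right_right 1
  have heq : C (s - t) * b + 1 * (a - C s * b) = a - C t * b := by
    rw [C_sub]
    ring
  rwa [heq] at this

end

/-- For coprime `a b : ℂ[X]`, not both constant, `N = max (deg a) (deg b)`, and pairwise
distinct `t₁, …, t_r ∈ ℂ`, the total excess multiplicity of the polynomials `a - tᵢ·b`
(number of roots with multiplicity minus number of distinct roots, summed over `i`)
is at most `2N - 2`. -/
theorem stmt1 (a b : ℂ[X]) (hab : IsCoprime a b)
    (hconst : ¬(a.natDegree = 0 ∧ b.natDegree = 0))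
    (N : ℕ) (hN : N = max a.natDegree b.natDegree)
    (r : ℕ) (t : Fin r → ℂ) (ht : Function.Injective t) :
    ∑ i, (Multiset.card (a - C (t i) * b).roots
        - (a - C (t i) * b).roots.toFinset.card) ≤ 2 * N - 2 := by
  have hw : wronskian a b ≠ 0 := by
    rw [Ne, hab.wronskian_eq_zero_iff]
    exact fun h => hconst
      ⟨derivative_eq_zero.mp h.1, derivative_eq_zero.mp h.2⟩
  have hdvd : ∏ i, EuclideanDomain.divRadical (a - C (t i) * b) ∣ wronskian a b := by
    refine Fintype.prod_dvd_of_coprime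
      (fun i j hij => (isCoprime_sub_C_mul hab (ht.ne hij)).divRadical) fun i => ?_
    rw [← wronskian_sub_C_mul_left a b (t i)]
    exact divRadical_dvd_wronskian_left _ _
  have hne := Finset.prod_ne_zero_iff.mp (ne_zero_of_dvd_ne_zero hw hdvd)
  calc
    _ ≤ ∑ i, (EuclideanDomain.divRadical (a - C (t i) * b)).natDegree :=
      Finset.sum_le_sum fun i _ => card_roots_sub_card_toFinset_le_natDegree_divRadical _
    _ = (∏ i, EuclideanDomain.divRadical (a - C (t i) * b)).natDegree :=
      (natDegree_prod _ _ hne).symm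
    _ ≤ (wronskian a b).natDegree := natDegree_le_of_dvd hdvd hw
    _ ≤ 2 * N - 2 := hN ▸ natDegree_wronskian_le_two_mul_max_sub_two hw
end

section
/- Let r ≥ 1 and N ≥ 1 be natural numbers, and for 1 ≤ i ≤ r let eᵢ, pᵢ, qᵢ, sᵢ be natural numbers with eᵢ ≥ 2. Assume (i) pᵢ + qᵢ + eᵢ·sᵢ ≤ N for every i, and (ii) ∑_{i=1}^r (pᵢ + qᵢ + sᵢ) ≥ (r − 2)·N + 2 (an inequality of integers). Set ε = ∑_{i=1}^r 1/eᵢ and e_∞ = max(e₁,…,e_r). Then (1 − 1/e_∞) · ∑_{i=1}^r (pᵢ + qᵢ) ≥ (r − ε − 2)·N + 2, as an inequality of rational numbers. -/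
/-- Arithmetic core of inequality (b-1) of Theorem 3.1: with `eᵢ ≥ 2`,
`pᵢ + qᵢ + eᵢ·sᵢ ≤ N` for all `i`, and `∑ (pᵢ + qᵢ + sᵢ) ≥ (r − 2)·N + 2`,
one has `(1 − 1/e_∞) · ∑ (pᵢ + qᵢ) ≥ (r − ε − 2)·N + 2` where
`ε = ∑ 1/eᵢ` and `e_∞ = max eᵢ`. -/
theorem stmt3 (r N : ℕ) (hr : 1 ≤ r) (hN : 1 ≤ N)
    (e p q s : Fin r → ℕ) (he : ∀ i, 2 ≤ e i)
    (h1 : ∀ i, p i + q i + e i * s i ≤ N)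
    (h2 : ((r : ℤ) - 2) * (N : ℤ) + 2 ≤ ∑ i, ((p i : ℤ) + (q i : ℤ) + (s i : ℤ))) :
    ((r : ℚ) - (∑ i, (1 : ℚ) / (e i : ℚ)) - 2) * (N : ℚ) + 2
      ≤ (1 - 1 / ((Finset.univ.sup e : ℕ) : ℚ)) * ∑ i, ((p i : ℚ) + (q i : ℚ)) := by
  have h2' : ((r : ℚ) - 2) * (N : ℚ) + 2 ≤ ∑ i, ((p i : ℚ) + (q i : ℚ) + (s i : ℚ)) := by
    exact_mod_cast h2
  have hterm : ∀ i, (p i : ℚ) + (q i : ℚ) + (s i : ℚ)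
      ≤ (1 - 1 / ((Finset.univ.sup e : ℕ) : ℚ)) * ((p i : ℚ) + (q i : ℚ))
        + (1 : ℚ) / (e i : ℚ) * (N : ℚ) := by
    intro i
    have hpos : (0 : ℚ) < e i := by
      have := he i
      exact_mod_cast (by omega : 0 < e i)
    have hle : (e i : ℚ) ≤ ((Finset.univ.sup e : ℕ) : ℚ) := by
      exact_mod_cast Finset.le_sup (Finset.mem_univ i)
    have hinv : 1 / ((Finset.univ.sup e : ℕ) : ℚ) ≤ 1 / (e i : ℚ) :=
      one_div_le_one_div_of_le hpos hle
    have hN' : (p i : ℚ) + q i + e i * s i ≤ N := by exact_mod_cast h1 i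
    have hdiv := mul_le_mul_of_nonneg_left hN' (one_div_pos.mpr hpos).le
    have hcancel : 1 / (e i : ℚ) * ((p i : ℚ) + q i + e i * s i)
        = 1 / (e i : ℚ) * ((p i : ℚ) + q i) + s i := by
      field_simp
    have hmul := mul_le_mul_of_nonneg_right hinv
      (by positivity : (0 : ℚ) ≤ (p i : ℚ) + q i)
    linarith
  have hsum := Finset.sum_le_sum fun i (_ : i ∈ Finset.univ) => hterm i
  rw [Finset.sum_add_distrib (f := fun i => (1 - 1 / ((Finset.univ.sup e : ℕ) : ℚ)) * _),
    ← Finset.mul_sum, ← Finset.sum_mul] at hsum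
  linarith
end

section
/- With the specialization setup below: the degree [F_{T₀} : ℂ(U)] is strictly smaller than [F : ℂ(T)] if and only if there exists θ ∈ F with θ not in the image of ℂ(T) in F and such that ĵ(θ) lies in the image of ℂ(U) in Ω. -/
set_option synthInstance.maxHeartbeats 800000

open Polynomial in
/-- If `F/E` is finite Galois and `F` meets `L` only in `E` inside `Ω`, then the compositum `L F`
has the same degree over `L` as `F` over `E`. -/
theorem finrank_adjoin_range_eq_of_forall_mem_range {E L F Ω : Type*} [Field E] [Field L] [Field F]
    [Field Ω] [Algebra E F] [FiniteDimensional E F] [IsGalois E F] [Algebra L Ω]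
    (φ : E →+* L) (j : F →+* Ω)
    (hj : ∀ x : E, j (algebraMap E F x) = algebraMap L Ω (φ x))
    (h : ∀ x : F, j x ∈ Set.range (algebraMap L Ω) → x ∈ Set.range (algebraMap E F)) :
    Module.finrank L (IntermediateField.adjoin L (Set.range j)) = Module.finrank E F := by
  obtain ⟨α, hα⟩ := Field.exists_primitive_element E F
  have hcomp : j.comp (algebraMap E F) = (algebraMap L Ω).comp φ := RingHom.ext hj
  have hαE : IsIntegral E α := IsIntegral.of_finite E α
  have hadj : IntermediateField.adjoin L (Set.range j) = IntermediateField.adjoin L {j α} := by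
    refine le_antisymm (IntermediateField.adjoin_le_iff.2 ?_)
      (IntermediateField.adjoin.mono L _ _ (by simp))
    rintro _ ⟨x, rfl⟩
    rw [SetLike.mem_coe]
    have hx : x ∈ IntermediateField.adjoin E {α} := hα ▸ IntermediateField.mem_top
    induction hx using IntermediateField.adjoin_induction with
    | mem x hx =>
      obtain rfl : x = α := hx
      exact IntermediateField.mem_adjoin_simple_self L _
    | algebraMap x => simpa only [hj] using IntermediateField.algebraMap_mem _ (φ x)
    | add x y _ _ hx hy => simpa only [map_add] using add_mem hx hy
    | inv x _ hx => simpa only [map_inv₀] using inv_mem hx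
    | mul x y _ _ hx hy => simpa only [map_mul] using mul_mem hx hy
  have hmap : ((minpoly E α).map φ).map (algebraMap L Ω)
      = ((minpoly E α).map (algebraMap E F)).map j := by
    rw [map_map, map_map, hcomp]
  have hroot : aeval (j α) ((minpoly E α).map φ) = 0 := by
    rw [← eval_map_algebraMap, hmap, eval_map, eval₂_at_apply, eval_map_algebraMap, minpoly.aeval,
      map_zero]
  have hmonic : ((minpoly E α).map φ).Monic := (minpoly.monic hαE).map φ
  have hjα : IsIntegral L (j α) := ⟨_, hmonic, by rwa [← aeval_def]⟩
  rw [hadj, IntermediateField.adjoin.finrank hjα, ← IntermediateField.finrank_top' (F := E), ← hα,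
    IntermediateField.adjoin.finrank hαE]
  refine le_antisymm ?_ ?_
  · exact (natDegree_le_of_dvd (minpoly.dvd L _ hroot) hmonic.ne_zero).trans_eq (natDegree_map φ)
  have hsplits : ((minpoly E α).map (algebraMap E F)).Splits := Normal.splits inferInstance α
  have hne : ((minpoly E α).map (algebraMap E F)).map j ≠ 0 :=
    (((minpoly.monic hαE).map _).map _).ne_zero
  have hdvd : (minpoly L (j α)).map (algebraMap L Ω)
      ∣ ((minpoly E α).map (algebraMap E F)).map j :=
    hmap ▸ Polynomial.map_dvd _ (minpoly.dvd L _ hroot)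
  have hlift : (minpoly L (j α)).map (algebraMap L Ω) ∈ lifts j := by
    refine ((hsplits.map j).of_dvd hne hdvd).mem_lift_of_roots_mem_range
      ((minpoly.monic hjα).map _) j fun x hx => ?_
    exact hsplits.mem_range_of_isRoot
      (((minpoly.monic hαE).map _).ne_zero) ((isRoot_of_mem_roots hx).dvd hdvd)
  have hliftE : minpoly L (j α) ∈ lifts φ := by
    rw [lifts_iff_coeff_lifts] at hlift ⊢
    intro n
    obtain ⟨c, hc⟩ := hlift n
    rw [coeff_map] at hc
    obtain ⟨e, rfl⟩ := h c ⟨_, hc.symm⟩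
    exact ⟨e, (algebraMap L Ω).injective (by rw [← hj, hc])⟩
  obtain ⟨r, hr, hdeg, hrm⟩ := lifts_and_natDegree_eq_and_monic hliftE (minpoly.monic hjα)
  rw [← hdeg]
  refine natDegree_le_of_dvd (minpoly.dvd E α (j.injective ?_)) hrm.ne_zero
  rw [map_zero, ← eval_map_algebraMap, ← eval₂_at_apply, ← eval_map, map_map, hcomp, ← map_map, hr,
    eval_map_algebraMap, minpoly.aeval]

/-- Translating a finite Galois extension `F/K` along `K → L` inside `Ω` makes the degree drop
exactly when `F` meets `L` in more than `K`. -/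
theorem finrank_adjoin_range_lt_iff {K L F Ω : Type*} [Field K] [Field L] [Field F]
    [Field Ω] [Algebra K F] [FiniteDimensional K F] [IsGalois K F] [Algebra L Ω]
    (φ : K →+* L) (j : F →+* Ω)
    (hj : ∀ x : K, j (algebraMap K F x) = algebraMap L Ω (φ x)) :
    Module.finrank L (IntermediateField.adjoin L (Set.range j)) < Module.finrank K F ↔
      ∃ θ : F, θ ∉ Set.range (algebraMap K F) ∧ j θ ∈ Set.range (algebraMap L Ω) := by
  let E : IntermediateField K F :=
    ((⊥ : IntermediateField L Ω).toSubfield.comap j).toIntermediateField fun x =>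
      IntermediateField.mem_bot.2 ⟨φ x, (hj x).symm⟩
  have hE (x : F) : x ∈ E ↔ j x ∈ Set.range (algebraMap L Ω) := IntermediateField.mem_bot
  let toBot : E →+* (⊥ : IntermediateField L Ω) :=
    (j.comp (algebraMap E F)).codRestrict _ fun x => x.2
  let ψ : E →+* L := (IntermediateField.botEquiv L Ω : _ →+* L).comp toBot
  have hψ (x : E) : j (algebraMap E F x) = algebraMap L Ω (ψ x) := by
    have := congrArg Subtype.val ((IntermediateField.botEquiv L Ω).symm_apply_apply (toBot x))
    rw [IntermediateField.botEquiv_symm] at this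
    exact this.symm
  rw [finrank_adjoin_range_eq_of_forall_mem_range ψ j hψ fun x hx => ⟨⟨x, (hE x).2 hx⟩, rfl⟩,
    ← Module.finrank_mul_finrank K E F, lt_mul_iff_one_lt_left Module.finrank_pos]
  have hone : 1 < Module.finrank K E ↔ ¬E = ⊥ := by
    rw [← IntermediateField.finrank_eq_one_iff.not]
    have : 0 < Module.finrank K E := Module.finrank_pos
    omega
  rw [hone, ← le_bot_iff, SetLike.not_le_iff_exists]
  simp only [hE, IntermediateField.mem_bot, and_comm]

/-- Specialization setup: `F/ℂ(T)` a finite Galois extension, `T₀ = a/b ∈ ℂ(U)`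
nonconstant, `φ : ℂ(T) → ℂ(U)` the embedding with `φ(T) = T₀`, `Ω` an algebraic closure
of `ℂ(U)`, `j : F → Ω` extending `φ`, and `F_{T₀}` the subfield of `Ω` generated over
`ℂ(U)` by `j(F)`. Then `[F_{T₀} : ℂ(U)] < [F : ℂ(T)]` if and only if there exists
`θ ∈ F`, not in the image of `ℂ(T)`, with `j(θ)` in the image of `ℂ(U)` in `Ω`. -/
theorem stmt6
    (F : Type*) [Field F] [Algebra (RatFunc ℂ) F] [FiniteDimensional (RatFunc ℂ) F]
    [IsGalois (RatFunc ℂ) F]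
    (a b : Polynomial ℂ) (hab : IsCoprime a b) (hb : b ≠ 0)
    (hnc : ¬(a.natDegree = 0 ∧ b.natDegree = 0))
    (φ : RatFunc ℂ →ₐ[ℂ] RatFunc ℂ)
    (hφ : φ RatFunc.X
      = algebraMap (Polynomial ℂ) (RatFunc ℂ) a / algebraMap (Polynomial ℂ) (RatFunc ℂ) b)
    (Ω : Type*) [Field Ω] [Algebra (RatFunc ℂ) Ω] [IsAlgClosed Ω]
    [Algebra.IsAlgebraic (RatFunc ℂ) Ω]
    (j : F →+* Ω)
    (hj : ∀ x : RatFunc ℂ, j (algebraMap (RatFunc ℂ) F x) = algebraMap (RatFunc ℂ) Ω (φ x)) :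
    Module.finrank (RatFunc ℂ)
        (IntermediateField.adjoin (RatFunc ℂ) (Set.range j) : IntermediateField (RatFunc ℂ) Ω)
      < Module.finrank (RatFunc ℂ) F ↔
    ∃ θ : F, θ ∉ Set.range (algebraMap (RatFunc ℂ) F) ∧
      j θ ∈ Set.range (algebraMap (RatFunc ℂ) Ω) := by
  exact finrank_adjoin_range_lt_iff (φ : RatFunc ℂ →+* RatFunc ℂ) j hj
end

section
/- Let G be a finite nilpotent group and k a natural number. If the abelianization G^{ab} of G has at least k pairwise distinct maximal cyclic subgroups, then G has at least k maximal cyclic subgroups that are pairwise non-conjugate (for two distinct members H, K of the family there is no x ∈ G with xHx⁻¹ = K). In other words, ν(G) ≥ ν(G^{ab}), where ν denotes the number of conjugacy classes of maximal cyclic subgroups. -/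
/-- A subgroup `C` of `G` is a *maximal cyclic subgroup* if `C` is cyclic and the only
cyclic subgroup of `G` containing `C` is `C` itself. -/
def IsMaximalCyclic {G : Type*} [Group G] (C : Subgroup G) : Prop :=
  IsCyclic C ∧ ∀ D : Subgroup G, IsCyclic D → C ≤ D → C = D

theorem IsCyclic.exists_le_isMaximalCyclic {G : Type*} [Group G] [Finite G] {C : Subgroup G}
    (hC : IsCyclic C) : ∃ D : Subgroup G, C ≤ D ∧ IsMaximalCyclic D := by
  obtain ⟨D, hCD, hD⟩ :=
    (Set.toFinite {D : Subgroup G | IsCyclic D}).exists_le_maximal (a := C) hC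
  exact ⟨D, hCD, hD.1, fun E hE hDE => le_antisymm hDE (hD.2 hE hDE)⟩

/-- A maximal cyclic subgroup of a quotient of a finite group is the image of a maximal cyclic
subgroup. -/
theorem IsMaximalCyclic.exists_map_eq {G A : Type*} [Group G] [Finite G] [Group A] {f : G →* A}
    (hf : Function.Surjective f) {C : Subgroup A} (hC : IsMaximalCyclic C) :
    ∃ H : Subgroup G, IsMaximalCyclic H ∧ H.map f = C := by
  obtain ⟨c, rfl⟩ := Subgroup.isCyclic_iff_exists_zpowers_eq_top C |>.1 hC.1
  obtain ⟨g, rfl⟩ := hf c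
  obtain ⟨H, hgH, hH⟩ := IsCyclic.exists_le_isMaximalCyclic
    (inferInstance : IsCyclic (Subgroup.zpowers g))
  have := hH.1
  refine ⟨H, hH, (hC.2 _ (isCyclic_of_surjective _ (f.subgroupMap_surjective H)) ?_).symm⟩
  rw [← MonoidHom.map_zpowers]
  exact Subgroup.map_mono hgH

theorem Subgroup.map_map_conj_of_comm {G A : Type*} [Group G] [CommGroup A] (f : G →* A)
    (H : Subgroup G) (x : G) : (H.map (MulAut.conj x).toMonoidHom).map f = H.map f := by
  rw [Subgroup.map_map]
  congr 1
  ext g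
  simp

/-- For a finite nilpotent group `G`: if the abelianization of `G` has at least `k`
pairwise distinct maximal cyclic subgroups, then `G` has at least `k` maximal cyclic
subgroups that are pairwise non-conjugate, i.e. `ν(G) ≥ ν(G^{ab})`. -/
theorem stmt9 (G : Type*) [Group G] [Finite G] [Group.IsNilpotent G] (k : ℕ)
    (hab : ∃ C : Fin k → Subgroup (Abelianization G),
      (∀ i, IsMaximalCyclic (C i)) ∧ Function.Injective C) :
    ∃ H : Fin k → Subgroup G, (∀ i, IsMaximalCyclic (H i)) ∧
      ∀ i j : Fin k, i ≠ j → ∀ x : G,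
        (H i).map (MulAut.conj x).toMonoidHom ≠ H j := by
  obtain ⟨C, hC, hinj⟩ := hab
  have hsurj : Function.Surjective (Abelianization.of (G := G)) := QuotientGroup.mk_surjective
  choose H hH hmap using fun i => (hC i).exists_map_eq hsurj
  refine ⟨H, hH, fun i j hij x hx => hij (hinj ?_)⟩
  rw [← hmap i, ← hmap j, ← hx, Subgroup.map_map_conj_of_comm]
end

section
/- Let s ≥ 2 and let d₁, …, d_s be natural numbers with 2 ≤ d₁ and dᵢ dividing d_{i+1} for 1 ≤ i < s, and set G = ℤ/d₁ℤ × ⋯ × ℤ/d_sℤ. For every (s−1)-tuple ε = (ε₁, …, ε_{s−1}) with εᵢ ∈ ℤ/dᵢℤ, the element g_ε = (ε₁, …, ε_{s−1}, 1) generates a maximal cyclic subgroup of G; moreover distinct tuples ε ≠ ε′ generate distinct subgroups ⟨g_ε⟩ ≠ ⟨g_{ε′}⟩. In particular G has at least d₁·d₂·⋯·d_{s−1} distinct maximal cyclic subgroups. -/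
/-- An additive subgroup `C` of `G` is a *maximal cyclic subgroup* if `C` is cyclic and
the only cyclic subgroup of `G` containing `C` is `C` itself. -/
def IsMaximalCyclicAdd {G : Type*} [AddGroup G] (C : AddSubgroup G) : Prop :=
  IsAddCyclic C ∧ ∀ D : AddSubgroup G, IsAddCyclic D → C ≤ D → C = D

/-- Each term of a finite divisibility chain divides the last one. -/
theorem dvd_last_of_dvd_succ {s : ℕ} {d : Fin (s + 1) → ℕ}
    (hdvd : ∀ i : Fin s, d i.castSucc ∣ d i.succ) (i : Fin (s + 1)) : d i ∣ d (Fin.last s) := by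
  induction i using Fin.reverseInduction with
  | last => exact dvd_rfl
  | cast i ih => exact (hdvd i).trans ih

/-- In a product of the groups `ZMod (d i)`, where every `d i` divides `n`, an integer congruent
to `1` modulo `n` acts as the identity. -/
theorem zsmul_eq_self_of_intCast_eq_one {ι : Type*} {d : ι → ℕ} {n : ℕ}
    (hd : ∀ i, d i ∣ n) {a : ℤ} (ha : (a : ZMod n) = 1) (x : (i : ι) → ZMod (d i)) :
    a • x = x := by
  ext i
  have h : (a : ZMod (d i)) = 1 := by
    rw [← map_intCast (ZMod.castHom (hd i) (ZMod (d i))), ha, map_one]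
  simp [h]

/-- If every `d i` divides `d j`, an element of the product of the groups `ZMod (d i)` whose `j`-th
coordinate is `1` generates a maximal cyclic subgroup. -/
theorem isMaximalCyclicAdd_zmultiples_of_apply_eq_one {ι : Type*} {d : ι → ℕ} {j : ι}
    (hd : ∀ i, d i ∣ d j) {g : (i : ι) → ZMod (d i)} (hg : g j = 1) :
    IsMaximalCyclicAdd (AddSubgroup.zmultiples g) := by
  refine ⟨inferInstance, fun D hD hle => le_antisymm hle ?_⟩
  obtain ⟨h, rfl⟩ := D.isAddCyclic_iff_exists_zmultiples_eq_top.mp hD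
  obtain ⟨k, rfl⟩ := AddSubgroup.mem_zmultiples_iff.mp (AddSubgroup.zmultiples_le.mp hle)
  obtain ⟨m, hm⟩ := ZMod.intCast_surjective (h j)
  rw [AddSubgroup.zmultiples_le, AddSubgroup.mem_zmultiples_iff]
  refine ⟨m, ?_⟩
  rw [← mul_zsmul']
  apply zsmul_eq_self_of_intCast_eq_one hd
  simpa [hm, mul_comm] using hg

/-- If every `d i` divides `d j`, elements of the product of the groups `ZMod (d i)` whose `j`-th
coordinate is `1` are determined by the subgroups they generate. -/
theorem eq_of_zmultiples_eq_of_apply_eq_one {ι : Type*} {d : ι → ℕ} {j : ι}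
    (hd : ∀ i, d i ∣ d j) {g g' : (i : ι) → ZMod (d i)} (hg : g j = 1) (hg' : g' j = 1)
    (h : AddSubgroup.zmultiples g = AddSubgroup.zmultiples g') : g = g' := by
  obtain ⟨k, rfl⟩ := AddSubgroup.mem_zmultiples_iff.mp
    (h ▸ AddSubgroup.mem_zmultiples g' : g' ∈ AddSubgroup.zmultiples g)
  exact (zsmul_eq_self_of_intCast_eq_one hd (by simpa [hg] using hg') g).symm

/-- In `G = ℤ/d₁ℤ × ⋯ × ℤ/d_{s+1}ℤ` (here indexed by `Fin (s+1)`, with `2 ≤ d 0` and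
`d i ∣ d (i+1)`), every element `g_ε = (ε₁, …, ε_s, 1)` generates a maximal cyclic
subgroup, and distinct tuples `ε ≠ ε'` generate distinct subgroups; in particular `G`
has at least `d 0 · ⋯ · d (s-1)` distinct maximal cyclic subgroups. -/
theorem stmt10 (s : ℕ) (hs : 1 ≤ s) (d : Fin (s + 1) → ℕ)
    (hd0 : 2 ≤ d 0) (hdvd : ∀ i : Fin s, d i.castSucc ∣ d i.succ)
    (ε : (i : Fin s) → ZMod (d i.castSucc)) :
    IsMaximalCyclicAdd (AddSubgroup.zmultiples
      (fun i => Fin.lastCases (1 : ZMod (d (Fin.last s))) (fun j => ε j) i :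
        (i : Fin (s + 1)) → ZMod (d i))) ∧
    ∀ ε' : (i : Fin s) → ZMod (d i.castSucc), ε ≠ ε' →
      AddSubgroup.zmultiples
        (fun i => Fin.lastCases (1 : ZMod (d (Fin.last s))) (fun j => ε j) i :
          (i : Fin (s + 1)) → ZMod (d i)) ≠
      AddSubgroup.zmultiples
        (fun i => Fin.lastCases (1 : ZMod (d (Fin.last s))) (fun j => ε' j) i :
          (i : Fin (s + 1)) → ZMod (d i)) := by
  have hd := dvd_last_of_dvd_succ hdvd
  refine ⟨isMaximalCyclicAdd_zmultiples_of_apply_eq_one hd (by simp), fun ε' hne h => hne ?_⟩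
  have heq := eq_of_zmultiples_eq_of_apply_eq_one hd (by simp) (by simp) h
  ext i
  simpa using congrFun heq i.castSucc
end

section
/- Let p be a prime number such that the Legendre symbols satisfy (2/p) = −1 and (3/p) = −1. Then the group PSL₂(𝔽_p), realized as the quotient of SL₂(ℤ/pℤ) (2×2 matrices over ℤ/pℤ of determinant 1) by its center, contains no element of order 6. -/
namespace Matrix

variable {R : Type*} [CommRing R]

theorem sq_eq_trace_smul_sub_one {M : Matrix (Fin 2) (Fin 2) R} (hM : M.det = 1) :
    M ^ 2 = M.trace • M - 1 := by
  rw [det_fin_two] at hM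
  ext i j
  fin_cases i <;> fin_cases j <;>
    simp [sq, mul_apply, Fin.sum_univ_two, trace_fin_two] <;>
    first | ring1 | linear_combination -hM

theorem pow_three_eq_smul_sub_smul_one {M : Matrix (Fin 2) (Fin 2) R} (hM : M.det = 1) :
    M ^ 3 = (M.trace ^ 2 - 1) • M - M.trace • (1 : Matrix (Fin 2) (Fin 2) R) := by
  have h := sq_eq_trace_smul_sub_one hM
  rw [pow_succ, h, sub_mul, smul_mul_assoc, ← sq, h, one_mul]
  module

theorem pow_six_eq_smul_sub_smul_one {M : Matrix (Fin 2) (Fin 2) R} (hM : M.det = 1) :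
    M ^ 6 = (M.trace * (M.trace ^ 2 - 1) * (M.trace ^ 2 - 3)) • M -
      (M.trace ^ 4 - 3 * M.trace ^ 2 + 1) • (1 : Matrix (Fin 2) (Fin 2) R) := by
  have h : M * M = M.trace • M - 1 := by rw [← sq, sq_eq_trace_smul_sub_one hM]
  rw [show 6 = 3 * 2 from rfl, pow_mul, pow_three_eq_smul_sub_smul_one hM, sq]
  simp only [sub_mul, mul_sub, smul_mul_assoc, mul_smul_comm, one_mul, mul_one, h]
  module

theorem SpecialLinearGroup.mem_center_of_eq_smul_one {A : SpecialLinearGroup (Fin 2) R} {r : R}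
    (h : (A : Matrix (Fin 2) (Fin 2) R) = r • (1 : Matrix (Fin 2) (Fin 2) R)) :
    A ∈ Subgroup.center (SpecialLinearGroup (Fin 2) R) := by
  refine mem_center_iff.mpr ⟨r, ?_, ?_⟩
  · have hdet := A.det_coe
    rwa [h, det_smul, det_one, mul_one] at hdet
  · rw [h, smul_one_eq_diagonal, scalar_apply]

/-- If `3` is not a square in `K`, then `PSL₂(K)` has no element of order `6`. -/
theorem SpecialLinearGroup.orderOf_quotient_center_ne_six {K : Type*} [Field K]
    (hK : ¬ IsSquare (3 : K))
    (g : SpecialLinearGroup (Fin 2) K ⧸ Subgroup.center (SpecialLinearGroup (Fin 2) K)) :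
    orderOf g ≠ 6 := by
  intro hg
  obtain ⟨A, rfl⟩ := QuotientGroup.mk_surjective g
  have hmem (n : ℕ) : A ^ n ∈ Subgroup.center (SpecialLinearGroup (Fin 2) K) ↔ 6 ∣ n := by
    rw [← QuotientGroup.eq_one_iff, QuotientGroup.mk_pow, ← hg, orderOf_dvd_iff_pow_eq_one]
  have hpow {n : ℕ} {r : K} (h : (A : Matrix (Fin 2) (Fin 2) K) ^ n = r • 1) : 6 ∣ n :=
    (hmem n).mp (mem_center_of_eq_smul_one (by rw [coe_pow, h]))
  obtain ⟨r, -, hr⟩ := mem_center_iff.mp ((hmem 6).mpr dvd_rfl)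
  set M : Matrix (Fin 2) (Fin 2) K := (A : Matrix (Fin 2) (Fin 2) K)
  have hM : M.det = 1 := A.det_coe
  rw [coe_pow, scalar_apply, ← smul_one_eq_diagonal, pow_six_eq_smul_sub_smul_one hM,
    eq_sub_iff_add_eq, ← add_smul] at hr
  by_cases hu : M.trace * (M.trace ^ 2 - 1) * (M.trace ^ 2 - 3) = 0
  · rcases mul_eq_zero.mp hu with hu | hu
    · rcases mul_eq_zero.mp hu with hu | hu
      · have : 6 ∣ 2 := hpow (r := -1) (by rw [sq_eq_trace_smul_sub_one hM, hu]; module)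
        lia
      · have : 6 ∣ 3 := hpow (r := -M.trace) (by
          rw [pow_three_eq_smul_sub_smul_one hM, hu]; module)
        lia
    · exact hK ⟨M.trace, by linear_combination -hu⟩
  · rw [← inv_smul_eq_iff₀ hu, smul_smul] at hr
    have : 6 ∣ 1 := hpow (by rw [pow_one, ← hr])
    lia

end Matrix

/-- If `p` is a prime with Legendre symbols `(2/p) = (3/p) = -1`, then
`PSL₂(𝔽_p)` (the quotient of `SL₂(ℤ/pℤ)` by its center) has no element of order `6`. -/
theorem stmt11 (p : ℕ) [Fact p.Prime]
    (h2 : legendreSym p 2 = -1) (h3 : legendreSym p 3 = -1) :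
    ∀ g : (Matrix.SpecialLinearGroup (Fin 2) (ZMod p)) ⧸
        Subgroup.center (Matrix.SpecialLinearGroup (Fin 2) (ZMod p)),
      orderOf g ≠ 6 :=
  Matrix.SpecialLinearGroup.orderOf_quotient_center_ne_six
    (by simpa using (legendreSym.eq_neg_one_iff p).mp h3)
end

section
/- Let p be a prime number such that the Legendre symbols satisfy (2/p) = −1 and (3/p) = −1, and let G = PSL₂(𝔽_p) be the quotient of SL₂(ℤ/pℤ) by its center. Then every element g ∈ G of order 2 and every element h ∈ G of order 3 are very different: there is no c ∈ G and integers a, b such that g is conjugate to c^a and h is conjugate to c^b. -/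
/-- Two elements `g, h` of a group are *very different* if there is no `c` and
integers `a, b` with `g` conjugate to `c^a` and `h` conjugate to `c^b`. -/
def VeryDifferent {G : Type*} [Group G] (g h : G) : Prop :=
  ¬ ∃ (c : G) (a b : ℤ), IsConj g (c ^ a) ∧ IsConj h (c ^ b)

theorem IsConj.orderOf_eq {G : Type*} [Group G] {x y : G} (h : IsConj x y) :
    orderOf x = orderOf y :=
  let ⟨c, hc⟩ := h
  SemiconjBy.orderOf_eq (c : G) hc

open Matrix in
theorem Matrix.SpecialLinearGroup.trace_pow_three {R : Type*} [CommRing R]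
    (A : SpecialLinearGroup (Fin 2) R) :
    (A ^ 3 : Matrix (Fin 2) (Fin 2) R).trace =
      (A : Matrix (Fin 2) (Fin 2) R).trace ^ 3 - 3 * (A : Matrix (Fin 2) (Fin 2) R).trace := by
  have hdet := A.det_coe
  rw [det_fin_two] at hdet
  simp only [pow_succ, pow_zero, one_mul, trace_fin_two, mul_apply, Fin.sum_univ_two]
  linear_combination (-3 * (A.1 0 0 + A.1 1 1)) * hdet

open Matrix in
theorem Matrix.SpecialLinearGroup.sq_eq_trace_smul_sub_one {R : Type*} [CommRing R]
    (A : SpecialLinearGroup (Fin 2) R) :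
    (A ^ 2 : Matrix (Fin 2) (Fin 2) R) =
      (A : Matrix (Fin 2) (Fin 2) R).trace • (A : Matrix (Fin 2) (Fin 2) R) - 1 := by
  have hdet := A.det_coe
  rw [det_fin_two] at hdet
  ext i j
  fin_cases i <;> fin_cases j <;>
    simp [sq, trace_fin_two, mul_apply] <;>
    grind

open Matrix in
/-- A non-central element of `SL₂` over a field squares to a central one exactly if its trace
vanishes. -/
theorem Matrix.SpecialLinearGroup.sq_mem_center_iff {F : Type*} [Field F]
    {A : SpecialLinearGroup (Fin 2) F} (hA : A ∉ Subgroup.center (SpecialLinearGroup (Fin 2) F)) :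
    A ^ 2 ∈ Subgroup.center (SpecialLinearGroup (Fin 2) F) ↔
      (A : Matrix (Fin 2) (Fin 2) F).trace = 0 := by
  have hsq := A.sq_eq_trace_smul_sub_one
  constructor
  · intro h
    by_contra ht
    refine hA (Subgroup.mem_center_iff.mpr fun B => ?_)
    have hB := congrArg Subtype.val (Subgroup.mem_center_iff.mp h B)
    simp only [SpecialLinearGroup.coe_mul, SpecialLinearGroup.coe_pow, hsq, mul_sub, sub_mul,
      mul_one, one_mul, sub_left_inj, mul_smul_comm, smul_mul_assoc] at hB
    exact Subtype.ext (smul_right_injective _ ht hB)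
  · intro ht
    rw [ht, zero_smul, zero_sub] at hsq
    refine Subgroup.mem_center_iff.mpr fun B => Subtype.ext ?_
    simp [hsq]

open Matrix in
theorem Matrix.SpecialLinearGroup.trace_mul_of_mem_center {R n : Type*} [CommRing R] [Fintype n]
    [DecidableEq n] (A : SpecialLinearGroup n R) {B : SpecialLinearGroup n R}
    (hB : B ∈ Subgroup.center (SpecialLinearGroup n R))
    (hA : (A : Matrix n n R).trace = 0) :
    (A * B : Matrix n n R).trace = 0 := by
  obtain ⟨r, -, hr⟩ := SpecialLinearGroup.mem_center_iff.mp hB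
  rw [← hr, scalar_apply, ← smul_one_eq_diagonal, mul_smul_comm, mul_one, trace_smul, hA, smul_zero]

/-- If `p` is a prime with Legendre symbols `(2/p) = (3/p) = -1`, then in
`PSL₂(𝔽_p)` (the quotient of `SL₂(ℤ/pℤ)` by its center) every element of order `2`
and every element of order `3` are very different. -/
theorem stmt12 (p : ℕ) [Fact p.Prime]
    (h2 : legendreSym p 2 = -1) (h3 : legendreSym p 3 = -1)
    (g h : (Matrix.SpecialLinearGroup (Fin 2) (ZMod p)) ⧸
        Subgroup.center (Matrix.SpecialLinearGroup (Fin 2) (ZMod p)))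
    (hg : orderOf g = 2) (hh : orderOf h = 3) :
    VeryDifferent g h := by
  rintro ⟨c, a, b, hga, hhb⟩
  obtain ⟨C, rfl⟩ := QuotientGroup.mk_surjective c
  rw [hga.orderOf_eq, ← QuotientGroup.mk_zpow] at hg
  rw [hhb.orderOf_eq, ← QuotientGroup.mk_zpow] at hh
  have hcomm : Commute (C ^ a) (C ^ b) := (Commute.refl C).zpow_zpow a b
  generalize C ^ a = X at hg hcomm
  generalize C ^ b = Y at hh hcomm
  have mem_iff (A : Matrix.SpecialLinearGroup (Fin 2) (ZMod p)) (k : ℕ) :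
      A ^ k ∈ Subgroup.center (Matrix.SpecialLinearGroup (Fin 2) (ZMod p)) ↔
        orderOf (A : Matrix.SpecialLinearGroup (Fin 2) (ZMod p) ⧸
          Subgroup.center (Matrix.SpecialLinearGroup (Fin 2) (ZMod p))) ∣ k := by
    rw [orderOf_dvd_iff_pow_eq_one, ← QuotientGroup.mk_pow, QuotientGroup.eq_one_iff]
  have hXY : orderOf ((X * Y : Matrix.SpecialLinearGroup (Fin 2) (ZMod p)) :
      Matrix.SpecialLinearGroup (Fin 2) (ZMod p) ⧸
        Subgroup.center (Matrix.SpecialLinearGroup (Fin 2) (ZMod p))) = 6 := by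
    have := (hcomm.map (QuotientGroup.mk' (Subgroup.center _))).orderOf_mul_eq_mul_orderOf_of_coprime
      (by simp [hg, hh, Nat.odd_iff])
    simpa [hg, hh] using this
  have notMem (A : Matrix.SpecialLinearGroup (Fin 2) (ZMod p))
      (hA : ¬ orderOf (A : Matrix.SpecialLinearGroup (Fin 2) (ZMod p) ⧸
        Subgroup.center (Matrix.SpecialLinearGroup (Fin 2) (ZMod p))) ∣ 1) :
      A ∉ Subgroup.center (Matrix.SpecialLinearGroup (Fin 2) (ZMod p)) := by
    rwa [← mem_iff, pow_one] at hA
  have hX : X.1.trace = 0 :=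
    (Matrix.SpecialLinearGroup.sq_mem_center_iff (notMem X (by simp [hg]))).mp
      ((mem_iff X 2).mpr (by simp [hg]))
  have hZ : (X * Y).1.trace ≠ 0 := fun h0 => by
    have := (mem_iff _ 2).mp
      ((Matrix.SpecialLinearGroup.sq_mem_center_iff (notMem (X * Y) (by rw [hXY]; norm_num))).mpr h0)
    rw [hXY] at this
    norm_num at this
  have hcube : ((X * Y).1 ^ 3).trace = 0 := by
    have h0 := Matrix.SpecialLinearGroup.trace_mul_of_mem_center X
      (Subgroup.mul_mem _ ((mem_iff X 2).mpr (by simp [hg])) ((mem_iff Y 3).mpr (by simp [hh]))) hX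
    rwa [← Matrix.SpecialLinearGroup.coe_mul, ← mul_assoc, ← pow_succ', ← hcomm.mul_pow,
      Matrix.SpecialLinearGroup.coe_pow] at h0
  rw [Matrix.SpecialLinearGroup.trace_pow_three] at hcube
  refine (legendreSym.eq_neg_one_iff p).mp h3 ⟨(X * Y).1.trace, ?_⟩
  refine mul_right_cancel₀ hZ ?_
  push_cast
  linear_combination -hcube
end

section
/- Let n ≥ 6 be an even integer and let σ₁, σ₂, σ₃, σ₄ be permutations in the symmetric group S_n on n letters whose cycle types are respectively {n} (an n-cycle), {n−1} (an (n−1)-cycle), {n−2, 2} (a product of a disjoint (n−2)-cycle and a transposition), and {2} (a transposition). Then σ₁, σ₂, σ₃, σ₄ are pairwise very different: for any two of them, say σ and τ, there is no ρ ∈ S_n and integers a, b such that σ is conjugate to ρ^a and τ is conjugate to ρ^b. -/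
section

open Equiv Equiv.Perm

/-- Permutations are very different if no permutation has two powers with their cycle types. -/
theorem veryDifferent_of_forall_zpow {α : Type*} [Fintype α] [DecidableEq α] {g h : Perm α}
    (H : ∀ (c : Perm α) (a b : ℤ), (c ^ a).cycleType = g.cycleType →
      (c ^ b).cycleType = h.cycleType → False) : VeryDifferent g h := by
  rintro ⟨c, a, b, hg, hh⟩
  exact H c a b (isConj_iff_cycleType_eq.mp hg).symm (isConj_iff_cycleType_eq.mp hh).symm

/-- A permutation commuting with `c` preserves the fixed points of `c`. -/
theorem apply_apply_eq_of_commute {α : Type*} {g h : Perm α} (hc : Commute g h) {x : α}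
    (hx : g x = x) : g (h x) = h x := by
  rw [← Perm.mul_apply, hc.eq, Perm.mul_apply, hx]

/-- A permutation commuting with a full cycle and having a fixed point is trivial. -/
theorem eq_one_of_commute_cycle {α : Type*} [Fintype α] [DecidableEq α] {g h : Perm α}
    (hg : g.IsCycle) (hs : g.support = Finset.univ) (hc : Commute g h) {x : α}
    (hx : h x = x) : h = 1 := by
  ext y
  have hmem : ∀ z, g z ≠ z := fun z => by
    rw [← Perm.mem_support, hs]; exact Finset.mem_univ z
  obtain ⟨i, rfl⟩ := hg.sameCycle (hmem x) (hmem y)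
  exact apply_apply_eq_of_commute (hc.symm.zpow_right i) hx

/-- If `c ^ a` is even and `c ^ b` is a transposition, then `c ^ a` fixes the points moved by
`c ^ b`. -/
theorem disjoint_support_zpow_of_isSwap {α : Type*} [Fintype α] [DecidableEq α] {c : Perm α}
    {a b : ℤ} (ha : sign (c ^ a) = 1) (hb : (c ^ b).IsSwap) :
    Disjoint (c ^ a).support (c ^ b).support := by
  have hc : sign c = -1 := by
    rcases Int.units_eq_one_or (sign c) with h | h
    · have := hb.sign_eq
      rw [map_zpow, h, one_zpow] at this
      exact absurd this (by decide)
    · exact h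
  have hae : Even a := by
    by_contra hodd
    rw [Int.not_even_iff_odd] at hodd
    rw [map_zpow, hc, hodd.neg_one_zpow] at ha
    exact absurd ha (by decide)
  obtain ⟨k, rfl⟩ := hae
  have hcomm : Commute (c ^ b) c := (Commute.refl c).zpow_left b
  have hpres : ∀ x ∈ (c ^ b).support, c x ∈ (c ^ b).support := by
    intro x hx
    rw [Perm.mem_support] at hx ⊢
    rw [← Perm.mul_apply, hcomm.eq, Perm.mul_apply]
    exact fun h => hx (c.injective h)
  have hsq : ∀ x ∈ (c ^ b).support, (c * c) x = x := by
    obtain ⟨u, v, huv, heq⟩ := hb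
    rw [heq, support_swap huv] at hpres ⊢
    have hu := hpres u (by simp)
    have hv := hpres v (by simp)
    have hne : c u ≠ c v := fun h => huv (c.injective h)
    simp only [Finset.mem_insert, Finset.mem_singleton] at hu hv ⊢
    rintro x (rfl | rfl) <;> grind [Perm.mul_apply]
  rw [Finset.disjoint_right]
  intro x hx
  rw [Perm.notMem_support, zpow_add, ← (Commute.refl c).mul_zpow]
  exact zpow_apply_eq_self_of_apply_eq_self (hsq x hx) k

/-- A permutation with a cycle of length `k` has a point fixed by its `k`-th power. -/
theorem exists_pow_apply_eq_self_of_mem_cycleType {α : Type*} [Fintype α] [DecidableEq α]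
    {g : Perm α} {k : ℕ} (hk : k ∈ g.cycleType) : ∃ x, (g ^ k) x = x := by
  rw [cycleType_def, Multiset.mem_map] at hk
  obtain ⟨f, hf, rfl⟩ := hk
  have hf' := mem_cycleFactorsFinset_iff.mp hf
  obtain ⟨x, hx⟩ := hf'.1.nonempty_support
  refine ⟨x, ?_⟩
  rw [Function.comp_apply, ← hf'.1.orderOf]
  have key : ∀ m : ℕ, (g ^ m) x = (f ^ m) x := fun m => by
    induction m with
    | zero => simp
    | succ m ih =>
      rw [pow_succ', pow_succ', Perm.mul_apply, Perm.mul_apply, ih]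
      exact (hf'.2 _ (pow_apply_mem_support.mpr hx)).symm
  rw [key, pow_orderOf_eq_one, Perm.one_apply]

end

/-- For even `n ≥ 6`, permutations in `S_n` of cycle types `{n}`, `{n-1}`, `{n-2, 2}`
and `{2}` are pairwise very different. -/
theorem stmt13 (n : ℕ) (hn : 6 ≤ n) (hne : Even n)
    (σ₁ σ₂ σ₃ σ₄ : Equiv.Perm (Fin n))
    (h1 : σ₁.cycleType = {n}) (h2 : σ₂.cycleType = {n - 1})
    (h3 : σ₃.cycleType = {n - 2, 2}) (h4 : σ₄.cycleType = {2}) :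
    VeryDifferent σ₁ σ₂ ∧ VeryDifferent σ₁ σ₃ ∧ VeryDifferent σ₁ σ₄ ∧
    VeryDifferent σ₂ σ₃ ∧ VeryDifferent σ₂ σ₄ ∧ VeryDifferent σ₃ σ₄ := by
  have hcomm (c : Equiv.Perm (Fin n)) (a b : ℤ) : Commute (c ^ a) (c ^ b) :=
    Commute.zpow_zpow_self c a b
  have full {g : Equiv.Perm (Fin n)} (hg : g.cycleType.sum = n) : g.support = Finset.univ := by
    rw [← Finset.card_eq_iff_eq_univ, ← Equiv.Perm.sum_cycleType, hg, Fintype.card_fin]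
  have exists_fixed {g : Equiv.Perm (Fin n)} (hg : g.cycleType.sum < n) : ∃ x, g x = x := by
    by_contra! h
    have : g.support = Finset.univ := by ext x; simpa using h x
    rw [Equiv.Perm.sum_cycleType, this, Finset.card_univ, Fintype.card_fin] at hg
    exact hg.false
  have cycle {g : Equiv.Perm (Fin n)} {k : ℕ} (hg : g.cycleType = {k}) : g.IsCycle := by
    rw [← Equiv.Perm.card_cycleType_eq_one, hg, Multiset.card_singleton]
  have swap {g : Equiv.Perm (Fin n)} (hg : g.cycleType = {2}) : g.IsSwap := by
    rw [← Equiv.Perm.card_support_eq_two, ← Equiv.Perm.sum_cycleType, hg, Multiset.sum_singleton]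
  have sum3 : (n - 2) + 2 = n := by omega
  refine ⟨?_, ?_, ?_, ?_, ?_, ?_⟩ <;>
    refine veryDifferent_of_forall_zpow fun c a b hg hh => ?_ <;>
    simp only [h1, h2, h3, h4] at hg hh
  · obtain ⟨x, hx⟩ := exists_fixed (g := c ^ b) (by rw [hh, Multiset.sum_singleton]; omega)
    exact (cycle hh).ne_one (eq_one_of_commute_cycle (cycle hg) (full (by simp [hg]))
      (hcomm c a b) hx)
  · obtain ⟨x, hx⟩ := exists_pow_apply_eq_self_of_mem_cycleType (g := c ^ b) (k := 2)
      (by simp [hh])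
    have hsq := eq_one_of_commute_cycle (cycle hg) (full (by simp [hg]))
      ((hcomm c a b).pow_right 2) hx
    have hdvd : n - 2 ∣ 2 := (Equiv.Perm.dvd_of_mem_cycleType (by simp [hh])).trans
      (orderOf_dvd_of_pow_eq_one hsq)
    have := Nat.le_of_dvd two_pos hdvd
    omega
  · obtain ⟨x, hx⟩ := exists_fixed (g := c ^ b) (by rw [hh, Multiset.sum_singleton]; omega)
    exact (cycle hh).ne_one (eq_one_of_commute_cycle (cycle hg) (full (by simp [hg]))
      (hcomm c a b) hx)
  · have hcard : (c ^ a).supportᶜ.card = 1 := by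
      rw [Finset.card_compl, ← Equiv.Perm.sum_cycleType, hg, Multiset.sum_singleton,
        Fintype.card_fin]
      omega
    obtain ⟨p, hp⟩ := Finset.card_eq_one.mp hcard
    have hfix (x : Fin n) : (c ^ a) x = x ↔ x = p := by
      simpa using Finset.ext_iff.mp hp x
    have hbp : (c ^ b) p = p :=
      (hfix _).mp (apply_apply_eq_of_commute (hcomm c a b) ((hfix p).mpr rfl))
    have : p ∈ (c ^ b).support := by
      rw [full (by simp [hh, sum3])]; exact Finset.mem_univ p
    exact Equiv.Perm.mem_support.mp this hbp
  · have hsign : Equiv.Perm.sign (c ^ a) = 1 := by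
      rw [Equiv.Perm.sign_of_cycleType, hg]
      simp only [Multiset.sum_singleton, Multiset.card_singleton]
      exact Even.neg_one_pow (by rwa [Nat.sub_add_cancel (by omega)])
    have hcard := Finset.card_le_univ ((c ^ a).support ∪ (c ^ b).support)
    rw [Finset.card_union_of_disjoint (disjoint_support_zpow_of_isSwap hsign (swap hh)),
      ← Equiv.Perm.sum_cycleType, ← Equiv.Perm.sum_cycleType, hg, hh, Multiset.sum_singleton,
      Multiset.sum_singleton, Fintype.card_fin] at hcard
    omega
  · have hsum : (c ^ a).cycleType.sum = n := by simp [hg, sum3]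
    have hsign : Equiv.Perm.sign (c ^ a) = 1 := by
      rw [Equiv.Perm.sign_of_cycleType, hsum, hg]
      exact Even.neg_one_pow (hne.add (by simp))
    have hcard := Finset.card_le_univ ((c ^ a).support ∪ (c ^ b).support)
    rw [Finset.card_union_of_disjoint (disjoint_support_zpow_of_isSwap hsign (swap hh)),
      ← Equiv.Perm.sum_cycleType, ← Equiv.Perm.sum_cycleType, hsum, hh, Multiset.sum_singleton,
      Fintype.card_fin] at hcard
    omega
end

section
/- Let n ≥ 7 be an odd integer and let g₁, g₂, g₃, g₄ be elements of the alternating group A_n whose cycle types (as permutations of n letters) are respectively {n} (an n-cycle), {n−3, 2} (a disjoint product of an (n−3)-cycle and a transposition), {n−2} (an (n−2)-cycle with two fixed points), and {n−4} (an (n−4)-cycle with four fixed points). Then g₁, g₂, g₃, g₄ are pairwise very different in A_n: for any two of them, say g and h, there is no ρ ∈ A_n and integers a, b such that g is conjugate in A_n to ρ^a and h is conjugate in A_n to ρ^b. -/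
open Equiv.Perm in
/-- The order of a permutation `y` commuting with `x` divides the order of the centralizer
of `x`, when the cycle lengths of `x` are pairwise distinct. -/
theorem orderOf_dvd_of_commute_of_nodup_cycleType {α : Type*} [Fintype α] [DecidableEq α]
    {x y : Equiv.Perm α} (h : Commute x y) (hx : x.cycleType.Nodup) :
    orderOf y ∣ (Fintype.card α - x.cycleType.sum).factorial * x.cycleType.prod := by
  have hy : y ∈ Subgroup.centralizer {x} :=
    Subgroup.mem_centralizer_singleton_iff.2 h.eq.symm
  have hd := Subgroup.orderOf_dvd_natCard _ hy
  rw [nat_card_centralizer, Finset.prod_eq_one, mul_one] at hd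
  · exact hd
  · intro i hi
    rw [Multiset.count_eq_one_of_mem hx (Multiset.mem_toFinset.1 hi), Nat.factorial_one]

/-- If the cycle lengths of `g` are pairwise distinct and the order of `h` does not divide the
order of the centralizer of `g`, then `g` and `h` are very different. -/
theorem veryDifferent_of_not_lcm_cycleType_dvd {α : Type*} [Fintype α] [DecidableEq α]
    {g h : alternatingGroup α} (hg : (g : Equiv.Perm α).cycleType.Nodup)
    (hgh : ¬ (h : Equiv.Perm α).cycleType.lcm ∣
      (Fintype.card α - (g : Equiv.Perm α).cycleType.sum).factorial *
        (g : Equiv.Perm α).cycleType.prod) :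
    VeryDifferent g h := by
  rintro ⟨c, a, b, hga, hhb⟩
  have cycleType_eq {u v : alternatingGroup α} (huv : IsConj u v) :
      (u : Equiv.Perm α).cycleType = (v : Equiv.Perm α).cycleType :=
    Equiv.Perm.isConj_iff_cycleType_eq.1 ((alternatingGroup α).subtype.map_isConj huv)
  rw [cycleType_eq hga] at hg hgh
  rw [cycleType_eq hhb, Equiv.Perm.lcm_cycleType] at hgh
  refine hgh (orderOf_dvd_of_commute_of_nodup_cycleType ?_ hg)
  exact (Commute.refl c).zpow_zpow a b |>.map (alternatingGroup α).subtype

/-- An odd number other than `1` does not divide a multiple of itself plus a power of two. -/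
theorem Odd.not_dvd_mul_add_two_pow {d : ℕ} (hd : Odd d) (hd1 : d ≠ 1) (q j : ℕ) :
    ¬ d ∣ d * q + 2 ^ j := by
  rw [Nat.dvd_add_right (dvd_mul_right d q)]
  exact fun h => hd1 ((Nat.Coprime.pow_right j hd.coprime_two_right).eq_one_of_dvd h)

/-- For odd `n ≥ 7`, elements of the alternating group `A_n` of cycle types `{n}`,
`{n-3, 2}`, `{n-2}` and `{n-4}` are pairwise very different in `A_n`. -/
theorem stmt14 (n : ℕ) (hn : 7 ≤ n) (hno : Odd n)
    (g₁ g₂ g₃ g₄ : alternatingGroup (Fin n))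
    (h1 : (g₁ : Equiv.Perm (Fin n)).cycleType = {n})
    (h2 : (g₂ : Equiv.Perm (Fin n)).cycleType = {n - 3, 2})
    (h3 : (g₃ : Equiv.Perm (Fin n)).cycleType = {n - 2})
    (h4 : (g₄ : Equiv.Perm (Fin n)).cycleType = {n - 4}) :
    VeryDifferent g₁ g₂ ∧ VeryDifferent g₁ g₃ ∧ VeryDifferent g₁ g₄ ∧
    VeryDifferent g₂ g₃ ∧ VeryDifferent g₂ g₄ ∧ VeryDifferent g₃ g₄ := by
  obtain ⟨m, rfl⟩ := hno
  obtain ⟨k, rfl⟩ : ∃ k, m = k + 3 := ⟨m - 3, by omega⟩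
  rw [show 2 * (k + 3) + 1 - 3 = 2 * k + 4 by omega] at h2
  rw [show 2 * (k + 3) + 1 - 2 = 2 * k + 5 by omega] at h3
  rw [show 2 * (k + 3) + 1 - 4 = 2 * k + 3 by omega] at h4
  have not_dvd_three := Odd.not_dvd_mul_add_two_pow (d := 2 * k + 3) ⟨k + 1, by ring⟩ (by omega)
  have not_dvd_five := Odd.not_dvd_mul_add_two_pow (d := 2 * k + 5) ⟨k + 2, by ring⟩ (by omega)
  have c1 : 2 * (k + 3) + 1 - (2 * (k + 3) + 1) = 0 := by omega
  have c2 : 2 * (k + 3) + 1 - (2 * k + 4 + 2) = 1 := by omega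
  have c3 : 2 * (k + 3) + 1 - (2 * k + 5) = 2 := by omega
  refine ⟨?_, ?_, ?_, ?_, ?_, ?_⟩ <;>
    refine veryDifferent_of_not_lcm_cycleType_dvd (by simp [h1, h2, h3]) fun hdvd => ?_ <;>
    simp only [h1, h2, h3, h4, Fintype.card_fin, Multiset.lcm_singleton, normalize_eq,
      Multiset.insert_eq_cons, Multiset.lcm_cons, Multiset.sum_cons, Multiset.prod_cons,
      Multiset.sum_singleton, Multiset.prod_singleton, c1, c2, c3, Nat.factorial, one_mul] at hdvd
  · have := (dvd_lcm_right _ _).trans hdvd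
    omega
  · exact not_dvd_five 1 1 (by convert hdvd using 1; ring)
  · exact not_dvd_three 1 2 (by convert hdvd using 1; ring)
  · refine not_dvd_five 1 1 ?_
    have := Nat.dvd_sub (dvd_mul_right (2 * k + 5) 3) hdvd
    convert this using 1
    omega
  · exact not_dvd_three 2 1 (by convert hdvd using 1; ring)
  · exact not_dvd_three 2 2 (by convert hdvd using 1; ring)
end

section
/- Let n ≥ 5, let ρ be a permutation of a set with n elements, and let a be an integer. If ρ^a has cycle type {n−2, 2} (a disjoint product of an (n−2)-cycle and a transposition), then ρ has cycle type {n−2, 2}. -/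
open Equiv.Perm

/-- If some integer power of a permutation `ρ` of a set with `n ≥ 5` elements has
cycle type `{n-2, 2}` (a disjoint product of an `(n-2)`-cycle and a transposition),
then `ρ` has cycle type `{n-2, 2}`. -/
theorem stmt19 {α : Type*} [Fintype α] [DecidableEq α] (n : ℕ) (hn : 5 ≤ n)
    (hcard : Fintype.card α = n) (ρ : Equiv.Perm α) (a : ℤ)
    (h : (ρ ^ a).cycleType = {n - 2, 2}) : ρ.cycleType = {n - 2, 2} := by
  obtain ⟨d, τ, hστ, hd, hdc, hd2⟩ := mem_cycleType_iff.1 (show 2 ∈ (ρ ^ a).cycleType by simp [h])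
  obtain ⟨x, y, hxy, rfl⟩ := card_support_eq_two.1 hd2
  have hτ : τ.cycleType = {n - 2} := by
    rw [hστ, hd.cycleType_mul, hdc.cycleType, hd2, Multiset.pair_comm,
      Multiset.insert_eq_cons, ← Multiset.singleton_add] at h
    exact add_left_cancel h
  have hτc : τ.IsCycle := card_cycleType_eq_one.1 (by simp [hτ])
  have hτcard : τ.support.card = n - 2 := by simpa [hτ] using τ.sum_cycleType.symm
  have hdisj := disjoint_iff_disjoint_support.1 hd
  have hτx : τ x = x := by simpa [hxy.symm] using hd x
  have hτy : τ y = y := by simpa [hxy] using hd y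
  have hσx : (ρ ^ a) x = y := by simp [hστ, hτx]
  have hσy : (ρ ^ a) y = x := by simp [hστ, hτy]
  have hmem {z : α} (hz : ((ρ ^ a) ^ 2) z = z) : z = x ∨ z = y := by
    by_contra! hne
    have hzτ : τ z ≠ z := by
      have huniv : (Equiv.swap x y).support ∪ τ.support = Finset.univ := by
        rw [← Finset.card_eq_iff_eq_univ, Finset.card_union_of_disjoint hdisj]
        omega
      have := huniv ▸ Finset.mem_univ z
      simpa [support_swap hxy, hne] using this
    have hsq : ((ρ ^ a) ^ 2) z = (τ ^ 2) z := by
      rw [hστ, hd.commute.mul_pow]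
      simp [sq]
    have h1 := hτc.pow_eq_one_iff.2 ⟨z, hzτ, hsq ▸ hz⟩
    have h2 := Nat.le_of_dvd two_pos (orderOf_dvd_of_pow_eq_one h1)
    rw [hτc.orderOf] at h2
    omega
  have hcomm (z : α) : ((ρ ^ a) ^ 2) (ρ z) = ρ (((ρ ^ a) ^ 2) z) :=
    DFunLike.congr_fun (((Commute.refl ρ).zpow_left a).pow_left 2) z
  have hρx : ρ x = y := by
    refine (hmem (by rw [hcomm]; simp [sq, hσx, hσy])).resolve_left fun hx ↦ hxy ?_
    rw [← hσx, zpow_apply_eq_self_of_apply_eq_self hx]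
  have hρy : ρ y = x := by
    refine (hmem (by rw [hcomm]; simp [sq, hσx, hσy])).resolve_right fun hy ↦ hxy ?_
    rw [← hσy, zpow_apply_eq_self_of_apply_eq_self hy]
  obtain ⟨π, hπ⟩ : ∃ π, ρ = Equiv.swap x y * π := ⟨Equiv.swap x y * ρ, by simp⟩
  have hπx : π x = x := by
    simpa [hρx] using congrArg (Equiv.swap x y) (DFunLike.congr_fun hπ x).symm
  have hπy : π y = y := by
    simpa [hρy] using congrArg (Equiv.swap x y) (DFunLike.congr_fun hπ y).symm
  have hdπ : (Equiv.swap x y).Disjoint π := by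
    intro z
    by_cases hzx : z = x
    · exact .inr (hzx ▸ hπx)
    by_cases hzy : z = y
    · exact .inr (hzy ▸ hπy)
    exact .inl (Equiv.swap_apply_of_ne_of_ne hzx hzy)
  have hpow : ρ ^ a = Equiv.swap x y ^ a * π ^ a := by rw [hπ, hdπ.commute.mul_zpow]
  have hswap : Equiv.swap x y ^ a = Equiv.swap x y := by
    rcases Int.even_or_odd' a with ⟨k, rfl | rfl⟩
    · have : (ρ ^ (2 * k)) x = x := by
        rw [hpow, mul_apply, zpow_apply_eq_self_of_apply_eq_self hπx, zpow_mul]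
        simp [zpow_ofNat, sq]
      exact absurd (this.symm.trans hσx) hxy
    · rw [zpow_add, zpow_mul]
      simp [zpow_ofNat, sq]
  have hπτ : π ^ a = τ := by
    rw [hστ, hswap] at hpow
    exact (mul_left_cancel hpow).symm
  have hle : (π ^ a).support ⊆ π.support := support_zpow_le π a
  have hsum : (Equiv.swap x y).support.card + π.support.card ≤ n := by
    rw [← hdπ.card_support_mul, ← hcard]
    exact Finset.card_le_univ _
  have hsupp : (π ^ a).support = π.support :=
    Finset.eq_of_subset_of_card_le hle (by rw [hπτ]; omega)
  have hπc : π.IsCycle := IsCycle.of_zpow (hπτ ▸ hτc) hsupp.ge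
  rw [hπ, hdπ.cycleType_mul, hdc.cycleType, hd2, hπc.cycleType, ← hsupp, hπτ, hτcard,
    Multiset.pair_comm, Multiset.insert_eq_cons, ← Multiset.singleton_add]
end
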